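/- For every continuous function φ on the unit sphere S² ⊂ ℝ³ there exists a unique function u on the closed unit ball of ℝ³ which is continuous on the closed ball, twice continuously differentiable on the open ball B, satisfies the hyperbolic-harmonicity equation (1 − ‖y‖²)·Δu(y) + 2⟨y, ∇u(y)⟩ = 0 for all y ∈ B (where Δu is the Euclidean Laplacian, i.e. the sum of the second partial derivatives, and ∇u the Euclidean gradient), and satisfies u = φ on S². (This is the solution of the Dirichlet problem at infinity for the hyperbolic Laplacian on 3-dimensional hyperbolic space, written in the Poincaré ball model.) -/

import Mathlib

open Metric

/-- The Euclidean Laplacian of `u : ℝ³ → ℝ` at `y`: sum of second partial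
derivatives in the coordinate directions. -/
noncomputable def euclLaplacian (u : EuclideanSpace ℝ (Fin 3) → ℝ)
    (y : EuclideanSpace ℝ (Fin 3)) : ℝ :=
  ∑ i : Fin 3,
    fderiv ℝ (fun x => fderiv ℝ u x (EuclideanSpace.single i 1)) y
      (EuclideanSpace.single i 1)

/-- `u` solves the Dirichlet problem at infinity (Poincaré ball model) for the
hyperbolic Laplacian on 3-dimensional hyperbolic space, with boundary value `φ`:
`u` is continuous on the closed unit ball, C² on the open unit ball, satisfies
`(1 − ‖y‖²)·Δu(y) + 2⟨y, ∇u(y)⟩ = 0` on the open ball (here `⟨y, ∇u(y)⟩` is the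
directional derivative of `u` at `y` in the direction `y`), and equals `φ` on
the unit sphere. -/
def IsDirichletSolution (φ u : EuclideanSpace ℝ (Fin 3) → ℝ) : Prop :=
  ContinuousOn u (closedBall 0 1) ∧
  ContDiffOn ℝ 2 u (ball 0 1) ∧
  (∀ y ∈ ball (0 : EuclideanSpace ℝ (Fin 3)) 1,
    (1 - ‖y‖ ^ 2) * euclLaplacian u y + 2 * fderiv ℝ u y y = 0) ∧
  (∀ y ∈ sphere (0 : EuclideanSpace ℝ (Fin 3)) 1, u y = φ y)

open MeasureTheory Filter Topology
open scoped ContDiff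

namespace HypDir

/-- The ambient Euclidean space. -/
abbrev E3 := EuclideanSpace ℝ (Fin 3)

/-- The hyperbolic operator. -/
noncomputable def hypL (u : E3 → ℝ) (y : E3) : ℝ :=
  (1 - ‖y‖ ^ 2) * euclLaplacian u y + 2 * fderiv ℝ u y y

lemma dir_differentiableAt {u : E3 → ℝ} {y : E3} (hu : ContDiffAt ℝ 2 u y) (v : E3) :
    DifferentiableAt ℝ (fun x => fderiv ℝ u x v) y := by
  have h : DifferentiableAt ℝ (fderiv ℝ u) y :=
    (hu.fderiv_right (m := 1) (by norm_num)).differentiableAt (by norm_num)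
  exact h.clm_apply (differentiableAt_const v)

lemma second_deriv_nonpos {u : E3 → ℝ} {y : E3} (hu : ContDiffAt ℝ 2 u y)
    (hmax : IsLocalMax u y) (v : E3) :
    fderiv ℝ (fun x => fderiv ℝ u x v) y v ≤ 0 := by
  by_contra hcon
  push Not at hcon
  have hline : ∀ t : ℝ, HasDerivAt (fun t : ℝ => y + t • v) v t := fun t => by
    simpa using ((hasDerivAt_id t).smul_const v).const_add y
  have hcont : Tendsto (fun t : ℝ => y + t • v) (𝓝 0) (𝓝 y) := by
    have := (hline 0).continuousAt.tendsto
    simpa using this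
  have hev : ∀ᶠ x in 𝓝 y, DifferentiableAt ℝ u x := by
    filter_upwards [hu.eventually (by simp)] with x hx
    exact hx.differentiableAt (by norm_num)
  have hd1 : deriv (fun t : ℝ => u (y + t • v)) =ᶠ[𝓝 0] fun t => fderiv ℝ u (y + t • v) v := by
    filter_upwards [hcont.eventually hev] with t ht
    exact (ht.hasFDerivAt.comp_hasDerivAt t (hline t)).deriv
  have hd2 : deriv (deriv (fun t : ℝ => u (y + t • v))) 0
      = fderiv ℝ (fun x => fderiv ℝ u x v) y v := by
    rw [hd1.deriv_eq]
    have h := (dir_differentiableAt hu v).hasFDerivAt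
    have h0 : y = y + (0 : ℝ) • v := by simp
    rw [h0] at h
    have := (h.comp_hasDerivAt (0 : ℝ) (hline 0)).deriv
    simpa [Function.comp_def] using this
  have hM : IsLocalMax (fun t : ℝ => u (y + t • v)) 0 := by
    have : ∀ᶠ t : ℝ in 𝓝 0, u (y + t • v) ≤ u y := hcont.eventually hmax
    simpa [IsLocalMax, IsMaxFilter] using this
  have hm : IsLocalMin (fun t : ℝ => u (y + t • v)) 0 := by
    apply isLocalMin_of_deriv_deriv_pos
    · rw [hd2]; exact hcon
    · exact hM.deriv_eq_zero
    · have h0 : ContinuousAt u (y + (0:ℝ) • v) := by simpa using hu.continuousAt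
      exact ContinuousAt.comp (f := fun t : ℝ => y + t • v) h0 (hline 0).continuousAt
  have hconst : (fun t : ℝ => u (y + t • v)) =ᶠ[𝓝 0] fun _ => u (y + (0 : ℝ) • v) := by
    filter_upwards [hM, hm] with t h1 h2
    exact le_antisymm h1 h2
  have : deriv (deriv (fun t : ℝ => u (y + t • v))) 0 = 0 := by
    rw [hconst.deriv.deriv_eq]
    simp
  linarith [hd2]

lemma hypL_add {u w : E3 → ℝ} {y : E3} (hu : ContDiffAt ℝ 2 u y) (hw : ContDiffAt ℝ 2 w y)
    (c : ℝ) : hypL (fun x => u x + c * w x) y = hypL u y + c * hypL w y := by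
  have e1 : ∀ᶠ x in 𝓝 y, fderiv ℝ (fun x => u x + c * w x) x
      = fderiv ℝ u x + c • fderiv ℝ w x := by
    filter_upwards [hu.eventually (by simp), hw.eventually (by simp)] with x h1 h2
    have h1 := (h1.differentiableAt (by norm_num)).hasFDerivAt
    have h2 := (h2.differentiableAt (by norm_num)).hasFDerivAt
    exact (h1.add (h2.const_mul c)).fderiv
  have e2 : ∀ v : E3, fderiv ℝ (fun x => fderiv ℝ (fun x => u x + c * w x) x v) y v
      = fderiv ℝ (fun x => fderiv ℝ u x v) y v + c * fderiv ℝ (fun x => fderiv ℝ w x v) y v := by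
    intro v
    have : (fun x => fderiv ℝ (fun x => u x + c * w x) x v)
        =ᶠ[𝓝 y] fun x => fderiv ℝ u x v + c * fderiv ℝ w x v := by
      filter_upwards [e1] with x hx
      rw [hx]; simp
    rw [this.fderiv_eq]
    have h1 := (dir_differentiableAt hu v).hasFDerivAt
    have h2 := (dir_differentiableAt hw v).hasFDerivAt
    have h3 : HasFDerivAt (fun x => fderiv ℝ u x v + c * fderiv ℝ w x v) _ y :=
      h1.add (h2.const_mul c)
    rw [h3.fderiv]; simp
  unfold hypL euclLaplacian
  simp only [e2, e1.self_of_nhds, Finset.sum_add_distrib, ← Finset.mul_sum]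
  simp
  ring

lemma hypL_normSq (y : E3) : hypL (fun x => ‖x‖ ^ 2) y = 6 - 2 * ‖y‖ ^ 2 := by
  have h1 : ∀ x : E3, fderiv ℝ (fun x : E3 => ‖x‖ ^ 2) x = 2 • innerSL ℝ x := fun x =>
    (hasStrictFDerivAt_norm_sq x).hasFDerivAt.fderiv
  have h2 : ∀ v : E3, fderiv ℝ (fun x : E3 => (2 • innerSL ℝ x) v) y v = 2 * ‖v‖ ^ 2 := by
    intro v
    have : HasFDerivAt (fun x : E3 => (2 • innerSL ℝ x) v) (2 • innerSL ℝ v) y := by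
      have : (fun x : E3 => (2 • innerSL ℝ x) v) = fun x => (2 • innerSL ℝ v) x := by
        ext x; simp [real_inner_comm]
      rw [this]
      exact (2 • innerSL ℝ v).hasFDerivAt
    rw [this.fderiv]; simp
  unfold hypL euclLaplacian
  simp only [h1, h2]
  simp
  ring

/-- Weak maximum principle. -/
lemma max_principle {w : E3 → ℝ} {r : ℝ} (hr : r ≤ 1)
    (hc : ContinuousOn w (closedBall 0 r)) (hd : ContDiffOn ℝ 2 w (ball 0 r))
    (hL : ∀ y ∈ ball (0 : E3) r, hypL w y = 0) (hb : ∀ y ∈ sphere (0 : E3) r, w y ≤ 0) :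
    ∀ y ∈ closedBall (0 : E3) r, w y ≤ 0 := by
  intro y hy
  have key : ∀ ε > 0, w y ≤ ε := by
    intro ε hε
    have hcont : ContinuousOn (fun x : E3 => w x + ε * ‖x‖ ^ 2) (closedBall 0 r) :=
      hc.add (by fun_prop)
    obtain ⟨z, hz, hzmax⟩ := (isCompact_closedBall (0 : E3) r).exists_isMaxOn ⟨y, hy⟩ hcont
    have hyz : w y + ε * ‖y‖ ^ 2 ≤ w z + ε * ‖z‖ ^ 2 := hzmax hy
    have hz' : ‖z‖ ≤ r := by simpa using hz
    rcases hz'.lt_or_eq with hlt | heq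
    · exfalso
      have hzb : z ∈ ball (0 : E3) r := by simpa using hlt
      have hnh : ball (0 : E3) r ∈ 𝓝 z := isOpen_ball.mem_nhds hzb
      have hdz : ContDiffAt ℝ 2 w z := hd.contDiffAt hnh
      have hns : ContDiffAt ℝ 2 (fun x : E3 => ‖x‖ ^ 2) z := (contDiff_norm_sq ℝ).contDiffAt
      have hsum : ContDiffAt ℝ 2 (fun x : E3 => w x + ε * ‖x‖ ^ 2) z :=
        hdz.add (contDiffAt_const.mul hns)
      have hlm : IsLocalMax (fun x : E3 => w x + ε * ‖x‖ ^ 2) z :=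
        hzmax.isLocalMax (Filter.mem_of_superset hnh ball_subset_closedBall)
      have h1 := hypL_add hdz hns ε
      rw [hL z hzb, hypL_normSq] at h1
      have hlap : euclLaplacian (fun x : E3 => w x + ε * ‖x‖ ^ 2) z ≤ 0 :=
        Finset.sum_nonpos fun i _ => second_deriv_nonpos hsum hlm _
      have hfd := hlm.fderiv_eq_zero
      unfold hypL at h1
      rw [hfd] at h1
      have hz1 : ‖z‖ ^ 2 < 1 := by
        have := norm_nonneg z
        nlinarith
      have : (1 - ‖z‖ ^ 2) * euclLaplacian (fun x : E3 => w x + ε * ‖x‖ ^ 2) z ≤ 0 :=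
        mul_nonpos_of_nonneg_of_nonpos (by linarith) hlap
      simp at h1
      nlinarith
    · have h2 := hb z (by simpa using heq)
      have h3 : ‖z‖ ^ 2 ≤ 1 := by
        have := norm_nonneg z
        nlinarith
      nlinarith [sq_nonneg ‖y‖]
  exact le_of_forall_pos_le_add (fun ε hε => by simpa using key ε hε)

lemma uniqueness {u w : E3 → ℝ} {r : ℝ} (hr : r ≤ 1)
    (hc : ContinuousOn u (closedBall 0 r)) (hd : ContDiffOn ℝ 2 u (ball 0 r))
    (hL : ∀ y ∈ ball (0 : E3) r, hypL u y = 0)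
    (hc' : ContinuousOn w (closedBall 0 r)) (hd' : ContDiffOn ℝ 2 w (ball 0 r))
    (hL' : ∀ y ∈ ball (0 : E3) r, hypL w y = 0)
    (hb : ∀ y ∈ sphere (0 : E3) r, u y = w y) :
    ∀ y ∈ closedBall (0 : E3) r, u y = w y := by
  have aux : ∀ {u w : E3 → ℝ},
    ContinuousOn u (closedBall 0 r) → ContDiffOn ℝ 2 u (ball 0 r) →
    (∀ y ∈ ball (0 : E3) r, hypL u y = 0) →
    ContinuousOn w (closedBall 0 r) → ContDiffOn ℝ 2 w (ball 0 r) →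
    (∀ y ∈ ball (0 : E3) r, hypL w y = 0) →
    (∀ y ∈ sphere (0 : E3) r, u y = w y) →
    ∀ y ∈ closedBall (0 : E3) r, u y ≤ w y := by
    intro u w hc hd hL hc' hd' hL' hb y hy
    have := max_principle (w := fun x => u x + (-1) * w x) hr
      (hc.add (continuousOn_const.mul hc')) (hd.add (contDiffOn_const.mul hd'))
      (fun y hy => by
        have hnh : ball (0 : E3) r ∈ 𝓝 y := isOpen_ball.mem_nhds hy
        rw [hypL_add (hd.contDiffAt hnh) (hd'.contDiffAt hnh), hL y hy, hL' y hy]; simp)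
      (fun y hy => by rw [hb y hy]; simp) y hy
    linarith
  intro y hy
  exact le_antisymm (aux hc hd hL hc' hd' hL' hb y hy)
    (aux hc' hd' hL' hc hd hL (fun y hy => (hb y hy).symm) y hy)

/-- Existence of a rotation-invariant probability measure on the sphere. -/
lemma exists_sphere_measure : ∃ σ : Measure E3, IsProbabilityMeasure σ ∧
    (∀ᵐ x ∂σ, x ∈ sphere (0 : E3) 1) ∧
    ∀ L : E3 ≃ₗᵢ[ℝ] E3, MeasurePreserving L σ σ := by
  let S : Set E3 := {x | 1 < ‖x‖} ∩ ball 0 2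
  have hSo : IsOpen S := (isOpen_lt continuous_const continuous_norm).inter isOpen_ball
  let μ : Measure E3 := volume.restrict S
  let n : E3 → E3 := fun x => ‖x‖⁻¹ • x
  have hn : Measurable n := 
    Measurable.smul (f := fun x : E3 => ‖x‖⁻¹) (g := fun x => x) measurable_norm.inv measurable_id
  have hfin : IsFiniteMeasure μ := by
    refine ⟨?_⟩
    rw [Measure.restrict_apply_univ]
    exact lt_of_le_of_lt (measure_mono Set.inter_subset_right) measure_ball_lt_top
  have hne : S.Nonempty := ⟨EuclideanSpace.single 0 (3/2 : ℝ), by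
    constructor <;> simp <;> norm_num [abs_of_pos]⟩
  have hμ0 : NeZero μ := ⟨by
    intro h
    have : μ Set.univ = 0 := by rw [h]; simp
    rw [Measure.restrict_apply_univ] at this
    exact (hSo.measure_pos volume hne).ne' this⟩
  have hinv : ∀ L : E3 ≃ₗᵢ[ℝ] E3, MeasurePreserving L μ μ := by
    intro L
    have := (L.measurePreserving).restrict_preimage (s := S) hSo.measurableSet
    have hpre : L ⁻¹' S = S := by
      ext x; simp [S]
    rwa [hpre] at this
  have hnL : ∀ (L : E3 ≃ₗᵢ[ℝ] E3), ⇑L ∘ n = n ∘ ⇑L := by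
    intro L; ext1 x; simp [n]
  let ν := (μ Set.univ)⁻¹ • μ
  have hν : IsProbabilityMeasure ν := inferInstance
  have hinv' : ∀ L : E3 ≃ₗᵢ[ℝ] E3, MeasurePreserving L ν ν := fun L => 
    ⟨(hinv L).measurable, by simp only [ν]; rw [Measure.map_smul, (hinv L).map_eq]⟩
  refine ⟨ν.map n, Measure.isProbabilityMeasure_map hn.aemeasurable, ?_, ?_⟩
  · refine (ae_map_iff (p := fun x => x ∈ sphere (0 : E3) 1) hn.aemeasurable
      isClosed_sphere.measurableSet).2 ?_
    apply Measure.ae_smul_measure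
    filter_upwards [ae_restrict_mem hSo.measurableSet] with x hx
    have : (0:ℝ) < ‖x‖ := lt_trans one_pos hx.1
    simp [n, norm_smul, this.ne']
  · intro L
    refine ⟨(hinv L).measurable, ?_⟩
    rw [Measure.map_map (hinv L).measurable hn, hnL, ← Measure.map_map hn (hinv L).measurable,
      (hinv' L).map_eq]

section Param

variable {F : Type*} [NormedAddCommGroup F] [NormedSpace ℝ F]

/-- Smoothness off the diagonal. -/
def SM (f : E3 → E3 → F) : Prop :=
  ∀ ξ y, y ≠ ξ → ContDiffAt ℝ ∞ (Function.uncurry f) (ξ, y)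

/-- Derivative in the second variable. -/
noncomputable def DD (f : E3 → E3 → F) : E3 → E3 → (E3 →L[ℝ] F) := fun ξ y => fderiv ℝ (f ξ) y

lemma SM.DD {f : E3 → E3 → F} (hf : SM f) : SM (DD f) := by
  intro ξ y hy
  have h1 : ContDiffAt ℝ ∞ (Function.uncurry fun (p : E3 × E3) z => f p.1 z) ((ξ, y), y) := by
    have := hf ξ y hy
    exact ContDiffAt.comp (f := fun q : (E3 × E3) × E3 => (q.1.1, q.2)) ((ξ, y), y) this
      (by fun_prop)
  exact ContDiffAt.fderiv (x₀ := (ξ, y)) (g := fun p : E3 × E3 => p.2)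
    (m := ∞) h1 contDiffAt_snd (by simp)

lemma SM.contDiffAt {f : E3 → E3 → F} (hf : SM f) {ξ y : E3} (h : y ≠ ξ) :
    ContDiffAt ℝ ∞ (f ξ) y :=
  ContDiffAt.comp (f := fun z : E3 => (ξ, z)) y (hf ξ y h) (by fun_prop)

lemma ne_of_ball_sphere {y ξ : E3} (hy : y ∈ ball (0 : E3) 1) (hξ : ξ ∈ sphere (0 : E3) 1) :
    y ≠ ξ := by
  rintro rfl
  simp at hy hξ
  linarith

lemma SM.continuousOn {f : E3 → E3 → F} (hf : SM f) :
    ContinuousOn (Function.uncurry f) (sphere (0 : E3) 1 ×ˢ ball (0 : E3) 1) := by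
  rintro ⟨ξ, y⟩ ⟨h1, h2⟩
  exact (hf ξ y (ne_of_ball_sphere h2 h1)).continuousAt.continuousWithinAt

variable {σ : Measure E3} [IsProbabilityMeasure σ]

lemma SM.integrable {f : E3 → E3 → F} (hf : SM f) (hσ : ∀ᵐ x ∂σ, x ∈ sphere (0 : E3) 1)
    {g : E3 → ℝ} (hg : Continuous g) {y : E3} (hy : y ∈ ball (0 : E3) 1) :
    Integrable (fun ξ => g ξ • f ξ y) σ := by
  have hc : ContinuousOn (fun ξ => g ξ • f ξ y) (sphere (0 : E3) 1) := by
    apply hg.continuousOn.smul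
    exact hf.continuousOn.comp (f := fun ξ => (ξ, y)) (by fun_prop) (fun ξ hξ => ⟨hξ, hy⟩)
  have := hc.integrableOn_compact (μ := σ) (isCompact_sphere 0 1)
  rwa [IntegrableOn, Measure.restrict_eq_self_of_ae_mem hσ] at this

lemma SM.hasFDerivAt {f : E3 → E3 → F} (hf : SM f) (hσ : ∀ᵐ x ∂σ, x ∈ sphere (0 : E3) 1)
    {g : E3 → ℝ} (hg : Continuous g) {y : E3} (hy : y ∈ ball (0 : E3) 1) :
    HasFDerivAt (fun y => ∫ ξ, g ξ • f ξ y ∂σ) (∫ ξ, g ξ • HypDir.DD f ξ y ∂σ) y := by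
  obtain ⟨ε, hε, hsub⟩ := nhds_basis_closedBall.mem_iff.1 (isOpen_ball.mem_nhds hy)
  have hcomp : IsCompact (sphere (0 : E3) 1 ×ˢ closedBall y ε) :=
    (isCompact_sphere 0 1).prod (isCompact_closedBall y ε)
  have hcont : ContinuousOn (fun p : E3 × E3 => g p.1 • Function.uncurry (HypDir.DD f) p)
      (sphere (0 : E3) 1 ×ˢ closedBall y ε) :=
    (hg.comp continuous_fst).continuousOn.smul
      (hf.DD.continuousOn.mono (Set.prod_mono le_rfl hsub))
  obtain ⟨C, hC⟩ := hcomp.exists_bound_of_continuousOn hcont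
  refine hasFDerivAt_integral_of_dominated_of_fderiv_le (closedBall_mem_nhds y hε)
    (bound := fun _ => C) (F' := fun x ξ => g ξ • HypDir.DD f ξ x) ?_ (hf.integrable hσ hg hy) (hf.DD.integrable hσ hg hy).1 ?_
    (integrable_const C) ?_
  · filter_upwards [isOpen_ball.mem_nhds hy] with x hx
    exact (hf.integrable hσ hg hx).1
  · filter_upwards [hσ] with ξ hξ x hx
    exact hC (ξ, x) ⟨hξ, hx⟩
  · filter_upwards [hσ] with ξ hξ x hx
    have := (hf.contDiffAt (ne_of_ball_sphere (hsub hx) hξ)).differentiableAt (by simp)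
    exact this.hasFDerivAt.const_smul (g ξ)

end Param

lemma two_le_infty : (2 : WithTop ℕ∞) ≤ ∞ := by
  first | exact_mod_cast (le_top : (2 : ℕ∞) ≤ ⊤) | simp | exact WithTop.coe_le_coe.2 le_top

/-- The hyperbolic Poisson kernel. -/
noncomputable def K (ξ y : E3) : ℝ := (1 - ‖y‖ ^ 2) ^ 2 / (‖y - ξ‖ ^ 2) ^ 2

lemma K_SM : SM K := by
  intro ξ y hy
  have h : (‖y - ξ‖ ^ 2) ^ 2 ≠ 0 := by
    have := norm_pos_iff.2 (sub_ne_zero.2 hy)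
    positivity
  have h1 : ContDiff ℝ ∞ (fun p : E3 × E3 => (1 - ‖p.2‖ ^ 2) ^ 2) :=
    (contDiff_const.sub (contDiff_snd.norm_sq ℝ)).pow 2
  have h2 : ContDiff ℝ ∞ (fun p : E3 × E3 => (‖p.2 - p.1‖ ^ 2) ^ 2) :=
    ((contDiff_snd.sub contDiff_fst).norm_sq ℝ).pow 2
  exact h1.contDiffAt.div h2.contDiffAt h

lemma line_deriv (y v : E3) : HasDerivAt (fun t : ℝ => y + t • v) v 0 := by
  simpa using ((hasDerivAt_id (0:ℝ)).smul_const v).const_add y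

lemma fderiv_eq_of_line {f : E3 → ℝ} {y v : E3} {c : ℝ} (hf : DifferentiableAt ℝ f y)
    (h : HasDerivAt (fun t : ℝ => f (y + t • v)) c 0) : fderiv ℝ f y v = c := by
  have h0 : y = y + (0 : ℝ) • v := by simp
  have h1 := hf.hasFDerivAt
  rw [h0] at h1
  have := (h1.comp_hasDerivAt (0 : ℝ) (line_deriv y v)).unique h
  simpa using this

lemma line_A (y v : E3) : HasDerivAt (fun t : ℝ => 1 - ‖y + t • v‖ ^ 2) (-(2 * inner ℝ y v)) 0 := by
  have := ((line_deriv y v).norm_sq).const_sub 1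
  simpa using this

lemma line_B (ξ y v : E3) :
    HasDerivAt (fun t : ℝ => ‖y + t • v - ξ‖ ^ 2) (2 * inner ℝ (y - ξ) v) 0 := by
  have := ((line_deriv y v).sub_const ξ).norm_sq
  simpa using this

lemma line_a (ξ y v : E3) :
    HasDerivAt (fun t : ℝ => (inner ℝ (y + t • v - ξ) v : ℝ)) (‖v‖ ^ 2) 0 := by
  have := ((line_deriv y v).sub_const ξ).inner ℝ (hasDerivAt_const (0:ℝ) v)
  simpa using this

lemma DK (ξ y v : E3) (h : y ≠ ξ) : fderiv ℝ (K ξ) y v =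
    -(4 * (1 - ‖y‖ ^ 2) * inner ℝ y v) / (‖y - ξ‖ ^ 2) ^ 2
      - 4 * (1 - ‖y‖ ^ 2) ^ 2 * inner ℝ (y - ξ) v / (‖y - ξ‖ ^ 2) ^ 3 := by
  have hB : ‖y - ξ‖ ≠ 0 := (norm_pos_iff.2 (sub_ne_zero.2 h)).ne'
  apply fderiv_eq_of_line ((K_SM.contDiffAt h).differentiableAt (by simp))
  have := ((line_A y v).pow 2).div ((line_B ξ y v).pow 2) (by simpa using hB)
  refine this.congr_deriv ?_
  simp
  field_simp
  ring

lemma D2K (ξ y v : E3) (h : y ≠ ξ) : fderiv ℝ (fun x => fderiv ℝ (K ξ) x v) y v =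
    8 * (inner ℝ y v) ^ 2 / (‖y - ξ‖ ^ 2) ^ 2 - 4 * (1 - ‖y‖ ^ 2) * ‖v‖ ^ 2 / (‖y - ξ‖ ^ 2) ^ 2
      + 32 * (1 - ‖y‖ ^ 2) * inner ℝ y v * inner ℝ (y - ξ) v / (‖y - ξ‖ ^ 2) ^ 3
      - 4 * (1 - ‖y‖ ^ 2) ^ 2 * ‖v‖ ^ 2 / (‖y - ξ‖ ^ 2) ^ 3
      + 24 * (1 - ‖y‖ ^ 2) ^ 2 * (inner ℝ (y - ξ) v) ^ 2 / (‖y - ξ‖ ^ 2) ^ 4 := by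
  have hB : ‖y - ξ‖ ≠ 0 := (norm_pos_iff.2 (sub_ne_zero.2 h)).ne'
  apply fderiv_eq_of_line
    (dir_differentiableAt ((K_SM.contDiffAt h).of_le two_le_infty) v)
  have hev : ∀ᶠ t : ℝ in 𝓝 0, y + t • v ≠ ξ := by
    have : Tendsto (fun t : ℝ => y + t • v) (𝓝 0) (𝓝 y) := by
      simpa using (line_deriv y v).continuousAt.tendsto
    exact this.eventually_ne h
  have ha : HasDerivAt (fun t : ℝ => (inner ℝ (y + t • v) v : ℝ)) (‖v‖ ^ 2) 0 := by
    simpa using line_a 0 y v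
  have h1 := (((line_A y v).const_mul 4).mul ha).neg.div ((line_B ξ y v).pow 2) (by simpa using hB)
  have h2 := ((((line_A y v).pow 2).const_mul 4).mul (line_a ξ y v)).div
    ((line_B ξ y v).pow 3) (by simpa using hB)
  have h3 := h1.sub h2
  refine HasDerivAt.congr_of_eventuallyEq (h3.congr_deriv ?_) ?_
  · simp
    field_simp
    ring
  · filter_upwards [hev] with t ht
    rw [DK _ _ _ ht]
    simp

lemma hypL_K {ξ y : E3} (hξ : ξ ∈ sphere (0 : E3) 1) (h : y ≠ ξ) : hypL (K ξ) y = 0 := by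
  have hB : ‖y - ξ‖ ≠ 0 := (norm_pos_iff.2 (sub_ne_zero.2 h)).ne'
  have hξ1 : ‖ξ‖ = 1 := by simpa using hξ
  unfold hypL euclLaplacian
  simp only [D2K ξ y _ h]
  rw [DK ξ y y h]
  have e1 : ‖y‖ ^ 2 = y 0 ^ 2 + y 1 ^ 2 + y 2 ^ 2 := by
    rw [EuclideanSpace.norm_sq_eq]; simp [Fin.sum_univ_three]
  have e2 : ξ 0 ^ 2 + ξ 1 ^ 2 + ξ 2 ^ 2 = 1 := by
    have : ‖ξ‖ ^ 2 = ξ 0 ^ 2 + ξ 1 ^ 2 + ξ 2 ^ 2 := by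
      rw [EuclideanSpace.norm_sq_eq]; simp [Fin.sum_univ_three]
    rw [← this, hξ1]; norm_num
  have e3 : ‖y - ξ‖ ^ 2 = (y 0 - ξ 0) ^ 2 + (y 1 - ξ 1) ^ 2 + (y 2 - ξ 2) ^ 2 := by
    rw [EuclideanSpace.norm_sq_eq]; simp [Fin.sum_univ_three]
  have e4 : (inner ℝ (y - ξ) y : ℝ)
      = (y 0 - ξ 0) * y 0 + (y 1 - ξ 1) * y 1 + (y 2 - ξ 2) * y 2 := by
    simp [PiLp.inner_apply, Fin.sum_univ_three]; ring
  have e5 : (inner ℝ y y : ℝ) = ‖y‖ ^ 2 := real_inner_self_eq_norm_sq y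
  have hv : ∀ i : Fin 3, ‖(EuclideanSpace.single i (1:ℝ) : E3)‖ = 1 := by intro i; simp
  have hi : ∀ (z : E3) (i : Fin 3), (inner ℝ z (EuclideanSpace.single i (1:ℝ)) : ℝ) = z i := by
    intro z i; simp [EuclideanSpace.inner_single_right]
  simp only [hv, hi, e5, e4, Fin.sum_univ_three, PiLp.sub_apply]
  set A := ‖y‖ ^ 2 with hA
  set B := ‖y - ξ‖ ^ 2 with hBB
  have hB' : B ≠ 0 := pow_ne_zero 2 hB
  generalize y 0 = a at *
  generalize y 1 = b at *
  generalize y 2 = c at *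
  generalize ξ 0 = p at *
  generalize ξ 1 = q at *
  generalize ξ 2 = r at *
  -- with S the inner product of y and y - ξ
  obtain ⟨S, hS⟩ : ∃ S, S = (a - p) * a + (b - q) * b + (c - r) * c := ⟨_, rfl⟩
  have r1 : B = 2 * S + 1 - A := by rw [e3, hS, e1]; linear_combination e2
  have : (1 - A) * (8 * A / B ^ 2 - 12 * (1 - A) / B ^ 2 + 32 * (1 - A) * S / B ^ 3
      - 12 * (1 - A) ^ 2 / B ^ 3 + 24 * (1 - A) ^ 2 * B / B ^ 4)
      + 2 * (-(4 * (1 - A) * A) / B ^ 2 - 4 * (1 - A) ^ 2 * S / B ^ 3) = 0 := by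
    have hS' : S = (B - 1 + A) / 2 := by linarith
    rw [hS']
    field_simp
    ring
  linear_combination this - (8 * (1 - A) / B ^ 2) * e1 * (1 : ℝ)
    - (24 * (1 - A) ^ 3 / B ^ 4) * e3 - (32 * (1 - A) ^ 2 / B ^ 3) * hS
    + (8 * (1 - A) ^ 2 / B ^ 3) * hS

section Sol

variable {σ : Measure E3} [IsProbabilityMeasure σ]

/-- The Poisson integral. -/
noncomputable def PU (σ : Measure E3) (g : E3 → ℝ) (y : E3) : ℝ := ∫ ξ, g ξ • K ξ y ∂σ

lemma PU_fderiv (hσ : ∀ᵐ x ∂σ, x ∈ sphere (0 : E3) 1) {g : E3 → ℝ} (hg : Continuous g)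
    {y : E3} (hy : y ∈ ball (0 : E3) 1) :
    HasFDerivAt (PU σ g) (∫ ξ, g ξ • DD K ξ y ∂σ) y := K_SM.hasFDerivAt hσ hg hy

lemma PU_fderiv2 (hσ : ∀ᵐ x ∂σ, x ∈ sphere (0 : E3) 1) {g : E3 → ℝ} (hg : Continuous g)
    {y : E3} (hy : y ∈ ball (0 : E3) 1) :
    HasFDerivAt (fderiv ℝ (PU σ g)) (∫ ξ, g ξ • DD (DD K) ξ y ∂σ) y := by
  refine (K_SM.DD.hasFDerivAt hσ hg hy).congr_of_eventuallyEq ?_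
  filter_upwards [isOpen_ball.mem_nhds hy] with x hx
  exact (PU_fderiv hσ hg hx).fderiv

lemma PU_contDiffOn (hσ : ∀ᵐ x ∂σ, x ∈ sphere (0 : E3) 1) {g : E3 → ℝ} (hg : Continuous g) :
    ContDiffOn ℝ 2 (PU σ g) (ball 0 1) := by
  have h2 : ContDiffOn ℝ 1 (fderiv ℝ (PU σ g)) (ball 0 1) := by
    have : (1 : WithTop ℕ∞) = 0 + 1 := by norm_num
    rw [this, contDiffOn_succ_iff_fderiv_of_isOpen isOpen_ball]
    refine ⟨fun y hy => (PU_fderiv2 hσ hg hy).differentiableAt.differentiableWithinAt,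
      by simp, ?_⟩
    rw [contDiffOn_zero]
    have hc : ContinuousOn (fun y => ∫ ξ, g ξ • DD (DD K) ξ y ∂σ) (ball 0 1) := fun y hy =>
      (K_SM.DD.DD.hasFDerivAt hσ hg hy).continuousAt.continuousWithinAt
    exact hc.congr fun y hy => (PU_fderiv2 hσ hg hy).fderiv
  have : (2 : WithTop ℕ∞) = 1 + 1 := by norm_num
  rw [this, contDiffOn_succ_iff_fderiv_of_isOpen isOpen_ball]
  exact ⟨fun y hy => (PU_fderiv hσ hg hy).differentiableAt.differentiableWithinAt, by simp, h2⟩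

lemma PU_hypL (hσ : ∀ᵐ x ∂σ, x ∈ sphere (0 : E3) 1) {g : E3 → ℝ} (hg : Continuous g)
    {y : E3} (hy : y ∈ ball (0 : E3) 1) : hypL (PU σ g) y = 0 := by
  have i1 := K_SM.DD.integrable hσ hg hy
  have i2 := K_SM.DD.DD.integrable hσ hg hy
  have h1 : ∀ v, fderiv ℝ (PU σ g) y v = ∫ ξ, g ξ * fderiv ℝ (K ξ) y v ∂σ := by
    intro v
    rw [(PU_fderiv hσ hg hy).fderiv, ContinuousLinearMap.integral_apply i1]
    rfl
  have j1 : ∀ v, Integrable (fun ξ => g ξ * fderiv ℝ (K ξ) y v) σ := fun v =>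
    i1.apply_continuousLinearMap v
  have e2 : ∀ v ξ, ξ ∈ sphere (0 : E3) 1 →
      g ξ * fderiv ℝ (fun x => fderiv ℝ (K ξ) x v) y v = (g ξ • DD (DD K) ξ y) v v := by
    intro v ξ hξ
    have hd : DifferentiableAt ℝ (fderiv ℝ (K ξ)) y :=
      (K_SM.DD.contDiffAt (ne_of_ball_sphere hy hξ)).differentiableAt (by simp)
    have := (hd.hasFDerivAt.clm_apply (hasFDerivAt_const v y)).fderiv
    rw [this]
    simp [DD]
    exact Or.inl rfl
  have j2' : ∀ v, Integrable (fun ξ => (g ξ • DD (DD K) ξ y) v v) σ := fun v =>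
    (i2.apply_continuousLinearMap v).apply_continuousLinearMap v
  have j2 : ∀ v, Integrable (fun ξ => g ξ * fderiv ℝ (fun x => fderiv ℝ (K ξ) x v) y v) σ := by
    intro v
    refine (j2' v).congr ?_
    filter_upwards [hσ] with ξ hξ
    exact (e2 v ξ hξ).symm
  have h2 : ∀ v, fderiv ℝ (fun x => fderiv ℝ (PU σ g) x v) y v
      = ∫ ξ, g ξ * fderiv ℝ (fun x => fderiv ℝ (K ξ) x v) y v ∂σ := by
    intro v
    have := ((PU_fderiv2 hσ hg hy).clm_apply (hasFDerivAt_const v y)).fderiv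
    rw [this]
    have h3 : (∫ ξ, g ξ • DD (DD K) ξ y ∂σ) v v = ∫ ξ, (g ξ • DD (DD K) ξ y) v v ∂σ := by
      rw [ContinuousLinearMap.integral_apply i2,
        ContinuousLinearMap.integral_apply (i2.apply_continuousLinearMap v)]
    simp only [ContinuousLinearMap.add_apply, ContinuousLinearMap.flip_apply,
      ContinuousLinearMap.comp_apply, ContinuousLinearMap.zero_apply, map_zero, zero_add]
    rw [h3]
    apply integral_congr_ae
    filter_upwards [hσ] with ξ hξ
    exact (e2 v ξ hξ).symm
  unfold hypL euclLaplacian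
  simp only [h1, h2]
  rw [← integral_finsetSum _ (fun i _ => j2 _), ← integral_const_mul, ← integral_const_mul,
    ← integral_add ((integrable_finsetSum _ (fun i _ => j2 _)).const_mul _) ((j1 _).const_mul _)]
  apply integral_eq_zero_of_ae
  filter_upwards [hσ] with ξ hξ
  have := hypL_K hξ (ne_of_ball_sphere hy hξ)
  unfold hypL euclLaplacian at this
  rw [← Finset.mul_sum]
  simp only [Pi.zero_apply]
  linear_combination (g ξ) * this

lemma hypL_const (c : ℝ) (y : E3) : hypL (fun _ => c) y = 0 := by
  simp [hypL, euclLaplacian]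

lemma PU_one (hσ : ∀ᵐ x ∂σ, x ∈ sphere (0 : E3) 1)
    (hinv : ∀ L : E3 ≃ₗᵢ[ℝ] E3, MeasurePreserving L σ σ) {y : E3} (hy : y ∈ ball (0 : E3) 1) :
    PU σ (fun _ => 1) y = 1 := by
  have hrad : ∀ z : E3, ‖z‖ = ‖y‖ → PU σ (fun _ => 1) z = PU σ (fun _ => 1) y := by
    intro z hz
    let L : E3 ≃ₗᵢ[ℝ] E3 := (ℝ ∙ (y - z))ᗮ.reflection
    have hL : L y = z := Submodule.reflection_sub hz.symm
    unfold PU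
    rw [← (hinv L).integral_comp L.toHomeomorph.measurableEmbedding]
    congr 1
    ext1 ξ
    have e1 : ‖z - L ξ‖ = ‖y - ξ‖ := by rw [← hL, ← map_sub, L.norm_map]
    simp [K, e1, hz]
  have hlt : ‖y‖ < 1 := by simpa using hy
  have hsub : closedBall (0 : E3) ‖y‖ ⊆ ball 0 1 := closedBall_subset_ball hlt
  have hcd := PU_contDiffOn hσ (continuous_const (y := (1 : ℝ)))
  have hu := uniqueness (u := PU σ (fun _ => 1)) (w := fun _ => PU σ (fun _ => 1) y) hlt.le
    (hcd.continuousOn.mono hsub) (hcd.mono (ball_subset_closedBall.trans hsub))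
    (fun x hx => PU_hypL hσ continuous_const (hsub (ball_subset_closedBall hx)))
    continuousOn_const contDiffOn_const (fun x _ => hypL_const _ x)
    (fun x hx => hrad x (by simpa using hx)) 0 (by simp)
  rw [← hu]
  unfold PU
  have : ∀ᵐ ξ ∂σ, (1 : ℝ) • K ξ 0 = 1 := by
    filter_upwards [hσ] with ξ hξ
    have : ‖ξ‖ = 1 := by simpa using hξ
    simp [K, this]
  rw [integral_congr_ae this]
  simp

lemma PU_boundary (hσ : ∀ᵐ x ∂σ, x ∈ sphere (0 : E3) 1)
    (hinv : ∀ L : E3 ≃ₗᵢ[ℝ] E3, MeasurePreserving L σ σ) {g : E3 → ℝ} (hg : Continuous g)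
    {η : E3} (hη : η ∈ sphere (0 : E3) 1) :
    Tendsto (PU σ g) (𝓝[ball 0 1] η) (𝓝 (g η)) := by
  obtain ⟨M, hM⟩ := (isCompact_sphere (0 : E3) 1).exists_bound_of_continuousOn hg.continuousOn
  have hM0 : 0 ≤ M := (norm_nonneg _).trans (hM η hη)
  rw [Metric.tendsto_nhds]
  intro ε hε
  obtain ⟨δ, hδ, hgδ⟩ := Metric.continuousAt_iff.1 hg.continuousAt (ε / 2) (by positivity)
  set C : ℝ := 2 * M / ((δ / 2) ^ 2) ^ 2 with hC
  have hC0 : 0 ≤ C := by positivity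
  have hη1 : ‖η‖ = 1 := by simpa using hη
  have hsmall : ∀ᶠ y in 𝓝 η, C * (1 - ‖y‖ ^ 2) ^ 2 < ε / 2 := by
    have : ContinuousAt (fun y : E3 => C * (1 - ‖y‖ ^ 2) ^ 2) η := by fun_prop
    refine this.eventually_lt continuousAt_const ?_
    simp [hη1]; positivity
  filter_upwards [self_mem_nhdsWithin, mem_nhdsWithin_of_mem_nhds hsmall,
    mem_nhdsWithin_of_mem_nhds (ball_mem_nhds η (half_pos hδ))] with y hy h1 h2
  have iK : Integrable (fun ξ => (1 : ℝ) • K ξ y) σ := K_SM.integrable hσ continuous_const hy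
  simp only [one_smul] at iK
  have igK : Integrable (fun ξ => g ξ * K ξ y) σ := K_SM.integrable hσ hg hy
  have hone : ∫ ξ, K ξ y ∂σ = 1 := by simpa [PU] using PU_one hσ hinv hy
  have hdiff : PU σ g y - g η = ∫ ξ, (g ξ - g η) * K ξ y ∂σ := by
    simp only [sub_mul]
    rw [integral_sub igK (iK.const_mul _), integral_const_mul, hone]
    simp [PU]
  have hK0 : ∀ ξ, 0 ≤ K ξ y := fun ξ => by unfold K; positivity
  have hbd : ∀ᵐ ξ ∂σ, ‖(g ξ - g η) * K ξ y‖ ≤ ε / 2 * K ξ y + C * (1 - ‖y‖ ^ 2) ^ 2 := by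
    filter_upwards [hσ] with ξ hξ
    rw [norm_mul, Real.norm_of_nonneg (hK0 ξ)]
    by_cases hd : dist ξ η < δ
    · have := hgδ hd
      rw [Real.dist_eq] at this
      have h3 : ‖g ξ - g η‖ * K ξ y ≤ ε / 2 * K ξ y :=
        mul_le_mul_of_nonneg_right this.le (hK0 ξ)
      have : 0 ≤ C * (1 - ‖y‖ ^ 2) ^ 2 := by positivity
      linarith
    · push Not at hd
      have h4 : δ / 2 ≤ ‖y - ξ‖ := by
        have h5 := dist_triangle ξ y η
        have h6 : dist y η < δ / 2 := h2
        rw [← dist_eq_norm, dist_comm]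
        linarith
      have h7 : ‖g ξ - g η‖ ≤ 2 * M := by
        have := norm_sub_le (g ξ) (g η)
        linarith [hM ξ hξ, hM η hη]
      have h8 : K ξ y ≤ (1 - ‖y‖ ^ 2) ^ 2 / ((δ / 2) ^ 2) ^ 2 := by
        unfold K
        gcongr
      calc ‖g ξ - g η‖ * K ξ y ≤ 2 * M * ((1 - ‖y‖ ^ 2) ^ 2 / ((δ / 2) ^ 2) ^ 2) := by
            gcongr
            exact hK0 ξ
        _ = C * (1 - ‖y‖ ^ 2) ^ 2 := by rw [hC]; ring
        _ ≤ _ := by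
            have := mul_nonneg (half_pos hε).le (hK0 ξ)
            linarith
  rw [Real.dist_eq, hdiff, ← Real.norm_eq_abs]
  have hint : Integrable (fun ξ => ε / 2 * K ξ y + C * (1 - ‖y‖ ^ 2) ^ 2) σ :=
    (iK.const_mul _).add (integrable_const _)
  refine lt_of_le_of_lt (norm_integral_le_of_norm_le hint hbd) ?_
  rw [integral_add (iK.const_mul _) (integrable_const _), integral_const_mul, hone]
  simp
  linarith

end Sol

lemma hypL_congr {u w : E3 → ℝ} {y : E3} (h : u =ᶠ[𝓝 y] w) : hypL u y = hypL w y := by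
  unfold hypL euclLaplacian
  rw [h.fderiv_eq]
  congr 2
  refine Finset.sum_congr rfl fun i _ => ?_
  have : (fun x => fderiv ℝ u x (EuclideanSpace.single i 1))
      =ᶠ[𝓝 y] fun x => fderiv ℝ w x (EuclideanSpace.single i 1) := by
    filter_upwards [h.fderiv (𝕜 := ℝ)] with x hx
    rw [hx]
  rw [this.fderiv_eq]

lemma existence (φ : E3 → ℝ) (hφ : ContinuousOn φ (sphere 0 1)) :
    ∃ u : E3 → ℝ, IsDirichletSolution φ u := by
  classical
  obtain ⟨σ, hp, hσ, hinv⟩ := exists_sphere_measure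
  obtain ⟨g, hg⟩ := ContinuousMap.exists_restrict_eq (isClosed_sphere (x := (0 : E3)) (ε := 1))
    ⟨_, hφ.restrict⟩
  have hgφ : ∀ y ∈ sphere (0 : E3) 1, g y = φ y := fun y hy => by
    have := DFunLike.congr_fun hg ⟨y, hy⟩
    simpa using this
  let u : E3 → ℝ := fun y => if y ∈ ball (0 : E3) 1 then PU σ g y else g y
  have hev : ∀ y ∈ ball (0 : E3) 1, u =ᶠ[𝓝 y] PU σ g := fun y hy => by
    filter_upwards [isOpen_ball.mem_nhds hy] with x hx
    exact if_pos hx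
  have hcd := PU_contDiffOn hσ g.continuous
  refine ⟨u, ?_, ?_, ?_, ?_⟩
  · intro y hy
    by_cases hyb : y ∈ ball (0 : E3) 1
    · have : ContinuousAt (PU σ g) y :=
        (PU_fderiv hσ g.continuous hyb).continuousAt
      exact (this.congr (hev y hyb).symm).continuousWithinAt
    · have hys : y ∈ sphere (0 : E3) 1 := by
        simp at hy hyb ⊢
        linarith
      have huy : u y = g y := if_neg hyb
      rw [ContinuousWithinAt, huy, ← ball_union_sphere, nhdsWithin_union]
      refine Tendsto.sup ?_ ?_
      · refine (PU_boundary hσ hinv g.continuous hys).congr' ?_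
        filter_upwards [self_mem_nhdsWithin] with x hx
        exact (if_pos hx).symm
      · have : Tendsto g (𝓝[sphere 0 1] y) (𝓝 (g y)) :=
          g.continuous.continuousAt.tendsto.mono_left nhdsWithin_le_nhds
        refine this.congr' ?_
        filter_upwards [self_mem_nhdsWithin] with x hx
        refine (if_neg ?_).symm
        simp at hx ⊢
        linarith
  · exact hcd.congr fun y hy => if_pos hy
  · intro y hy
    exact (hypL_congr (hev y hy)).trans (PU_hypL hσ g.continuous hy)
  · intro y hy
    rw [← hgφ y hy]
    refine if_neg ?_
    simp at hy ⊢
    linarith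

end HypDir

/-- Solvability and uniqueness of the Dirichlet problem at infinity for the
hyperbolic Laplacian in the Poincaré ball model of 3-dimensional hyperbolic
space: for every continuous `φ` on the unit sphere there is a function `u`,
unique as a function on the closed unit ball, which is continuous on the closed
ball, C² on the open ball, hyperbolically harmonic in the open ball, and equal
to `φ` on the sphere. -/
theorem dirichlet_problem_at_infinity
    (φ : EuclideanSpace ℝ (Fin 3) → ℝ)
    (hφ : ContinuousOn φ (sphere 0 1)) :
    ∃ u : EuclideanSpace ℝ (Fin 3) → ℝ, IsDirichletSolution φ u ∧
      ∀ u' : EuclideanSpace ℝ (Fin 3) → ℝ, IsDirichletSolution φ u' →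
        ∀ y ∈ closedBall (0 : EuclideanSpace ℝ (Fin 3)) 1, u' y = u y := by
  obtain ⟨u, hu⟩ := HypDir.existence φ hφ
  refine ⟨u, hu, fun u' hu' => ?_⟩
  exact HypDir.uniqueness le_rfl hu'.1 hu'.2.1 hu'.2.2.1 hu.1 hu.2.1 hu.2.2.1
    (fun y hy => (hu'.2.2.2 y hy).trans (hu.2.2.2 y hy).symm)
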